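/- Assume the families B and (G,B) satisfy positivity and that A_k ⊥⊥ G_k | B_k for every k = 0,…,p. With s_k := b_{a_k}((G,B)) − b_{a_k}(B) and r_k := [I_{ā_{k−1}}(Ā_{k−1}) / λ_{ā_{k−1}}(B̄_{k−1})] · (1_{{A_k = a_k}} / π_{a_k}(B_k) − 1) · s_k, one has E[r_k · r_i] = 0 for all 0 ≤ i < k ≤ p; in particular Cov(r_i, r_k) = 0. (Pairwise uncorrelatedness of the residual terms in the proof of Lemma 4.1.) -/

import Mathlib

open MeasureTheory ProbabilityTheory

noncomputable section

/-- The σ-algebra generated by a set of real-valued random variables. -/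
def genSig {Ω : Type*} (S : Set (Ω → ℝ)) : MeasurableSpace Ω :=
  ⨆ f ∈ S, MeasurableSpace.comap f (inferInstance : MeasurableSpace ℝ)

/-- Indicator `1_{A = a}` of the event that the random variable `A` takes the value `a`. -/
def ind {Ω : Type*} (A : Ω → ℝ) (a : ℝ) : Ω → ℝ := fun ω => if A ω = a then 1 else 0

/-- `I_{ā_{k-1}}(Ā_{k-1}) = ∏_{j<k} 1_{A_j = a_j}` (equal to `1` when `k = 0`). -/
def indUpto {Ω : Type*} (A : ℕ → Ω → ℝ) (a : ℕ → ℝ) (k : ℕ) : Ω → ℝ :=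
  fun ω => ∏ j ∈ Finset.range k, ind (A j) (a j) ω

variable {Ω : Type*} [MeasurableSpace Ω]

/-- Propensity `π_{a_k}(Z_k) = E[1_{A_k = a_k} ∣ σ(Z_k)]`. -/
def propen (μ : Measure Ω) (A : ℕ → Ω → ℝ) (a : ℕ → ℝ) (Z : ℕ → Set (Ω → ℝ)) (k : ℕ) : Ω → ℝ :=
  μ[ind (A k) (a k) | genSig (Z k)]

/-- Cumulative weight `λ_{ā_{k-1}}(Z̄_{k-1}) = ∏_{j<k} π_{a_j}(Z_j)` (equal to `1` when `k = 0`). -/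
def cumWeight (μ : Measure Ω) (A : ℕ → Ω → ℝ) (a : ℕ → ℝ) (Z : ℕ → Set (Ω → ℝ)) (k : ℕ) :
    Ω → ℝ :=
  fun ω => ∏ j ∈ Finset.range k, propen μ A a Z j ω

/-- The adjustment family `Z` satisfies positivity: the propensities are uniformly bounded away
from `0` almost surely, for every time `k = 0, …, p`. -/
def Positivity (μ : Measure Ω) (A : ℕ → Ω → ℝ) (a : ℕ → ℝ) (Z : ℕ → Set (Ω → ℝ)) (p : ℕ) :
    Prop :=
  ∃ c : ℝ, 0 < c ∧ ∀ k ≤ p, ∀ᵐ ω ∂μ, c ≤ propen μ A a Z k ω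

/-- Auxiliary downward recursion: `bAux μ A a Y Z p n` is the iterated regression
`b_{a_{p-n}}(Z)`. -/
def bAux (μ : Measure Ω) (A : ℕ → Ω → ℝ) (a : ℕ → ℝ) (Y : Ω → ℝ) (Z : ℕ → Set (Ω → ℝ))
    (p : ℕ) : ℕ → Ω → ℝ
  | 0 => fun ω =>
      (μ[fun ω' => Y ω' * ind (A p) (a p) ω' | genSig (Z p)]) ω / propen μ A a Z p ω
  | n + 1 => fun ω =>
      (μ[fun ω' => bAux μ A a Y Z p n ω' * ind (A (p - (n + 1))) (a (p - (n + 1))) ω' |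
          genSig (Z (p - (n + 1)))]) ω / propen μ A a Z (p - (n + 1)) ω

/-- Iterated regression `b_{a_k}(Z)`, for `k = 0, …, p`. -/
def breg (μ : Measure Ω) (A : ℕ → Ω → ℝ) (a : ℕ → ℝ) (Y : Ω → ℝ) (Z : ℕ → Set (Ω → ℝ))
    (p k : ℕ) : Ω → ℝ :=
  bAux μ A a Y Z p (p - k)

/-- `b_{a_{k-1}}(Z)` with the convention `b_{a_{-1}}(Z) = E[b_{a_0}(Z)]` (a constant). -/
def bregPrev (μ : Measure Ω) (A : ℕ → Ω → ℝ) (a : ℕ → ℝ) (Y : Ω → ℝ) (Z : ℕ → Set (Ω → ℝ))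
    (p k : ℕ) : Ω → ℝ :=
  if k = 0 then fun _ => ∫ ω, breg μ A a Y Z p 0 ω ∂μ else breg μ A a Y Z p (k - 1)

/-- The influence function `ψ_a(Z)`. -/
def psi (μ : Measure Ω) (A : ℕ → Ω → ℝ) (a : ℕ → ℝ) (Y : Ω → ℝ) (Z : ℕ → Set (Ω → ℝ))
    (p : ℕ) : Ω → ℝ := fun ω =>
  indUpto A a (p + 1) ω * (Y ω - breg μ A a Y Z p p ω) / cumWeight μ A a Z (p + 1) ω +
    ∑ k ∈ Finset.range (p + 1),
      indUpto A a k ω * (breg μ A a Y Z p k ω - bregPrev μ A a Y Z p k ω) /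
        cumWeight μ A a Z k ω

end

theorem genSig_mono {Ω : Type*} {S T : Set (Ω → ℝ)} (h : S ⊆ T) : genSig S ≤ genSig T :=
  biSup_mono h

theorem genSig_union {Ω : Type*} (S T : Set (Ω → ℝ)) :
    genSig (S ∪ T) = genSig S ⊔ genSig T :=
  iSup_union

theorem measurable_genSig_of_mem {Ω : Type*} {S : Set (Ω → ℝ)} {f : Ω → ℝ} (hf : f ∈ S) :
    Measurable[genSig S] f :=
  Measurable.mono (comap_measurable f) (le_biSup (fun f : Ω → ℝ =>
    MeasurableSpace.comap f (inferInstance : MeasurableSpace ℝ)) hf) le_rfl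

theorem ind_eq_indicator {Ω : Type*} (A : Ω → ℝ) (a : ℝ) :
    ind A a = (A ⁻¹' {a}).indicator fun _ => (1 : ℝ) := by
  ext ω
  by_cases h : A ω = a <;> simp [ind, h]

theorem measurable_ind {Ω : Type*} {m : MeasurableSpace Ω} {A : Ω → ℝ} (hA : Measurable A) (a : ℝ) :
    Measurable (ind A a) := by
  rw [ind_eq_indicator]
  exact measurable_const.indicator (hA (measurableSet_singleton a))

theorem isPiSystem_image2_inter {α : Type*} (m₁ m₂ : MeasurableSpace α) :
    IsPiSystem (Set.image2 (· ∩ ·) {s | MeasurableSet[m₁] s} {s | MeasurableSet[m₂] s}) := by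
  rintro _ ⟨u, hu, v, hv, rfl⟩ _ ⟨u', hu', v', hv', rfl⟩ -
  refine ⟨u ∩ u', MeasurableSet.inter hu hu', v ∩ v', MeasurableSet.inter hv hv', ?_⟩
  exact Set.inter_inter_inter_comm u u' v v'

theorem sup_eq_generateFrom_image2_inter {α : Type*} (m₁ m₂ : MeasurableSpace α) :
    m₁ ⊔ m₂ = MeasurableSpace.generateFrom
      (Set.image2 (· ∩ ·) {s | MeasurableSet[m₁] s} {s | MeasurableSet[m₂] s}) := by
  apply le_antisymm
  · refine sup_le (fun u hu => ?_) (fun v hv => ?_)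
    · exact MeasurableSpace.measurableSet_generateFrom ⟨u, hu, Set.univ, MeasurableSet.univ, by simp⟩
    · exact MeasurableSpace.measurableSet_generateFrom ⟨Set.univ, MeasurableSet.univ, v, hv, by simp⟩
  · refine MeasurableSpace.generateFrom_le ?_
    rintro _ ⟨u, hu, v, hv, rfl⟩
    exact MeasurableSet.inter ((le_sup_left : m₁ ≤ m₁ ⊔ m₂) u hu)
      ((le_sup_right : m₂ ≤ m₁ ⊔ m₂) v hv)

/-- Two integrable functions with equal integrals over a generating π-system containing the whole
space have equal integrals over every set of the generated σ-algebra. -/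
theorem setIntegral_eq_of_isPiSystem {α : Type*} {m m₀ : MeasurableSpace α} {μ : Measure α}
    (hm : m ≤ m₀) {S : Set (Set α)} (hS : m = MeasurableSpace.generateFrom S)
    (hpi : IsPiSystem S) (huniv : Set.univ ∈ S) {f g : α → ℝ} (hf : Integrable f μ)
    (hg : Integrable g μ) (hfg : ∀ t ∈ S, ∫ x in t, f x ∂μ = ∫ x in t, g x ∂μ)
    (t : Set α) (ht : MeasurableSet[m] t) : ∫ x in t, f x ∂μ = ∫ x in t, g x ∂μ := by
  have h_all : ∫ x, f x ∂μ = ∫ x, g x ∂μ := by simpa using hfg _ huniv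
  induction t, ht using MeasurableSpace.induction_on_inter hS hpi with
  | empty => simp
  | basic t ht => exact hfg t ht
  | compl t ht ih => rw [setIntegral_compl (hm t ht) hf, setIntegral_compl (hm t ht) hg, ih, h_all]
  | iUnion s hs hsm ih =>
    rw [integral_iUnion (fun i => hm _ (hsm i)) hs hf.integrableOn,
      integral_iUnion (fun i => hm _ (hsm i)) hs hg.integrableOn]
    exact tsum_congr ih

/-- If `m₁` and `m₂` are conditionally independent given `m'`, then conditioning an event of `m₁`
on `m₂` in addition to `m'` does not change its conditional probability. -/
theorem condExp_indicator_sup_of_condIndep {Ω : Type*} {m' m₁ m₂ mΩ : MeasurableSpace Ω}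
    [StandardBorelSpace Ω] {μ : Measure Ω} [IsFiniteMeasure μ] (hm' : m' ≤ mΩ) (hm₁ : m₁ ≤ mΩ)
    (hm₂ : m₂ ≤ mΩ) (h : CondIndep m' m₁ m₂ hm' μ) {s : Set Ω} (hs : MeasurableSet[m₁] s) :
    μ⟦s | m' ⊔ m₂⟧ =ᵐ[μ] μ⟦s | m'⟧ := by
  have hsup : m' ⊔ m₂ ≤ mΩ := sup_le hm' hm₂
  have hint : ∀ {t : Set Ω}, MeasurableSet t → Integrable (t.indicator fun _ => (1 : ℝ)) μ :=
    fun ht => (integrable_const 1).indicator ht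
  refine (ae_eq_condExp_of_forall_setIntegral_eq hsup (hint (hm₁ s hs))
    (fun _ _ _ => integrable_condExp.integrableOn) (fun t ht _ => ?_)
    (stronglyMeasurable_condExp.mono (le_sup_left : m' ≤ m' ⊔ m₂)).aestronglyMeasurable).symm
  refine setIntegral_eq_of_isPiSystem hsup (sup_eq_generateFrom_image2_inter m' m₂)
    (isPiSystem_image2_inter m' m₂) ⟨Set.univ, MeasurableSet.univ, Set.univ, MeasurableSet.univ,
      by simp⟩ integrable_condExp (hint (hm₁ s hs)) ?_ t ht
  rintro _ ⟨u, hu, v, hv, rfl⟩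
  have hv_meas : MeasurableSet v := hm₂ v hv
  have hmul : (v.indicator (μ⟦s | m'⟧)) = μ⟦s | m'⟧ * v.indicator fun _ => (1 : ℝ) := by
    ext ω
    by_cases hω : ω ∈ v <;> simp [hω]
  have hvint : Integrable (v.indicator (μ⟦s | m'⟧)) μ := integrable_condExp.indicator hv_meas
  calc ∫ ω in u ∩ v, (μ⟦s | m'⟧) ω ∂μ
      = ∫ ω in u, v.indicator (μ⟦s | m'⟧) ω ∂μ := (setIntegral_indicator hv_meas).symm
    _ = ∫ ω in u, (μ[v.indicator (μ⟦s | m'⟧) | m']) ω ∂μ := (setIntegral_condExp hm' hvint hu).symm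
    _ = ∫ ω in u, (μ⟦s ∩ v | m'⟧) ω ∂μ := by
      refine setIntegral_congr_ae (hm' u hu) ?_
      have hpull := condExp_mul_of_stronglyMeasurable_left (stronglyMeasurable_condExp (m := m'))
        (hmul ▸ hvint) (hint hv_meas)
      have hprod := (condIndep_iff m' m₁ m₂ hm' hm₁ hm₂ μ).1 h s v hs hv
      rw [hmul]
      filter_upwards [hpull, hprod] with ω h1 h2 _
      rw [h1, h2]
    _ = ∫ ω in u, (s ∩ v).indicator (fun _ => (1 : ℝ)) ω ∂μ :=
      setIntegral_condExp hm' (hint ((hm₁ s hs).inter hv_meas)) hu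
    _ = ∫ ω in u ∩ v, s.indicator (fun _ => (1 : ℝ)) ω ∂μ := by
      rw [← setIntegral_indicator hv_meas, Set.indicator_indicator, Set.inter_comm v s]

/-- An inverse-propensity residual is orthogonal to every function of the conditioning
variables. Integrability of the product is not needed: otherwise its integral is `0` anyway. -/
theorem integral_mul_div_sub_one_eq_zero {Ω : Type*} {m mΩ : MeasurableSpace Ω} {μ : Measure Ω}
    [IsFiniteMeasure μ] (hm : m ≤ mΩ) {W X q : Ω → ℝ} (hW : StronglyMeasurable[m] W)
    (hX : Integrable X μ) (hq : StronglyMeasurable[m] q) (hXq : μ[X | m] =ᵐ[μ] q)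
    {c : ℝ} (hc : 0 < c) (hcq : ∀ᵐ ω ∂μ, c ≤ q ω) :
    ∫ ω, W ω * (X ω / q ω - 1) ∂μ = 0 := by
  have hq_inv : StronglyMeasurable[m] q⁻¹ := hq.measurable.inv.stronglyMeasurable
  have hbound : ∀ᵐ ω ∂μ, ‖q⁻¹ ω‖ ≤ c⁻¹ := by
    filter_upwards [hcq] with ω hω
    rw [Pi.inv_apply, norm_inv, Real.norm_of_nonneg (hc.le.trans hω)]
    exact inv_anti₀ hc hω
  have hqX : Integrable (q⁻¹ * X) μ :=
    hX.bdd_mul (hq_inv.mono hm).aestronglyMeasurable hbound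
  have hR : Integrable (q⁻¹ * X - 1) μ := hqX.sub (integrable_const 1)
  have hR_zero : μ[q⁻¹ * X - 1 | m] =ᵐ[μ] 0 := by
    have h_one : μ[(1 : Ω → ℝ) | m] = 1 := condExp_const hm (1 : ℝ)
    filter_upwards [condExp_sub hqX (integrable_const (1 : ℝ)) m,
      condExp_mul_of_stronglyMeasurable_left hq_inv hqX hX, hXq, hcq] with ω h1 h2 h3 h4
    refine h1.trans ?_
    rw [Pi.sub_apply, h2, Pi.mul_apply, h3, Pi.inv_apply,
      inv_mul_cancel₀ (hc.trans_le h4).ne']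
    exact sub_eq_zero.2 (congrFun h_one ω).symm
  have h_eq : (fun ω => W ω * (X ω / q ω - 1)) = W * (q⁻¹ * X - 1) := by
    ext ω
    simp only [Pi.mul_apply, Pi.sub_apply, Pi.inv_apply, Pi.one_apply]
    ring
  rw [h_eq]
  by_cases hWR : Integrable (W * (q⁻¹ * X - 1)) μ
  · rw [← integral_condExp hm]
    refine integral_eq_zero_of_ae ?_
    filter_upwards [condExp_mul_of_stronglyMeasurable_left hW hWR hR, hR_zero] with ω h1 h2
    rw [h1, Pi.mul_apply, h2, Pi.zero_apply, mul_zero]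
  · exact integral_undef hWR

theorem stronglyMeasurable_propen {Ω : Type*} [MeasurableSpace Ω] (μ : Measure Ω)
    (A : ℕ → Ω → ℝ) (a : ℕ → ℝ) (Z : ℕ → Set (Ω → ℝ)) (k : ℕ) :
    StronglyMeasurable[genSig (Z k)] (propen μ A a Z k) :=
  stronglyMeasurable_condExp

theorem measurable_breg {Ω : Type*} [MeasurableSpace Ω] (μ : Measure Ω)
    (A : ℕ → Ω → ℝ) (a : ℕ → ℝ) (Y : Ω → ℝ) (Z : ℕ → Set (Ω → ℝ)) {p k : ℕ} (hk : k ≤ p) :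
    Measurable[genSig (Z k)] (breg μ A a Y Z p k) := by
  have haux : ∀ n, Measurable[genSig (Z (p - n))] (bAux μ A a Y Z p n) := by
    rintro (_ | n) <;>
    exact Measurable.div stronglyMeasurable_condExp.measurable
      (stronglyMeasurable_propen μ A a Z _).measurable
  have h := haux (p - k)
  rwa [Nat.sub_sub_self hk] at h

/-- The weighted indicator of the treatment history before time `k` is measurable with respect to
any σ-algebra containing the past treatments and past adjustment variables. -/
theorem measurable_indUpto_div_cumWeight {Ω : Type*} {m mΩ : MeasurableSpace Ω} (μ : Measure Ω)
    {A : ℕ → Ω → ℝ} (a : ℕ → ℝ) {Z : ℕ → Set (Ω → ℝ)} {k : ℕ}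
    (hA : ∀ j < k, Measurable[m] (A j)) (hZ : ∀ j < k, genSig (Z j) ≤ m) :
    Measurable[m] fun ω => indUpto A a k ω / cumWeight μ A a Z k ω := by
  refine Measurable.div ?_ ?_
  · exact Finset.measurable_prod _ fun j hj =>
      measurable_ind (hA j (Finset.mem_range.1 hj)) (a j)
  · exact Finset.measurable_prod _ fun j hj =>
      (stronglyMeasurable_propen μ A a Z j).measurable.mono (hZ j (Finset.mem_range.1 hj)) le_rfl

/-- pairwise uncorrelatedness of the residual terms, proof of Lemma 4.1.
Under positivity of `B` and `(G, B)` and `A_k ⊥⊥ G_k ∣ B_k` for all `k`, the residuals satisfy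
`E[r_k ⬝ r_i] = 0` for all `0 ≤ i < k ≤ p`; in particular `Cov(r_i, r_k) = 0`. -/
theorem residuals_uncorrelated {Ω : Type*} [mΩ : MeasurableSpace Ω] [StandardBorelSpace Ω]
    (P : Measure Ω) [IsProbabilityMeasure P] (p : ℕ)
    (A : ℕ → Ω → ℝ) (hA : ∀ k, Measurable (A k))
    (hAfin : ∀ k, (Set.range (A k)).Finite)
    (Y : Ω → ℝ) (hYm : Measurable Y) (hYbd : ∃ C : ℝ, ∀ ω, |Y ω| ≤ C)
    (a : ℕ → ℝ) (ha : ∀ k ≤ p, a k ∈ Set.range (A k))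
    (K G B : ℕ → Set (Ω → ℝ)) (hKfin : ∀ k, (K k).Finite)
    (hGle : ∀ k, genSig (G k) ≤ mΩ) (hBle : ∀ k, genSig (B k) ≤ mΩ)
    (hdisj : ∀ k ≤ p, Disjoint (G k) (B k))
    (hcover : ∀ k ≤ p, G k ∪ B k = A '' Set.Iio k ∪ ⋃ j ∈ Set.Iic k, K j)
    (hBpos : Positivity P A a B p)
    (hGBpos : Positivity P A a (fun k => G k ∪ B k) p)
    (hCI : ∀ k ≤ p,
      CondIndep (genSig (B k)) (MeasurableSpace.comap (A k) inferInstance) (genSig (G k))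
        (hBle k) P) :
    ∀ i k : ℕ, i < k → k ≤ p →
      (∫ ω,
          ((indUpto A a k ω / cumWeight P A a B k ω *
              (ind (A k) (a k) ω / propen P A a B k ω - 1) *
              (breg P A a Y (fun j => G j ∪ B j) p k ω - breg P A a Y B p k ω)) *
            (indUpto A a i ω / cumWeight P A a B i ω *
              (ind (A i) (a i) ω / propen P A a B i ω - 1) *
              (breg P A a Y (fun j => G j ∪ B j) p i ω - breg P A a Y B p i ω))) ∂P = 0) ∧
      ((∫ ω,
          ((indUpto A a k ω / cumWeight P A a B k ω *
              (ind (A k) (a k) ω / propen P A a B k ω - 1) *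
              (breg P A a Y (fun j => G j ∪ B j) p k ω - breg P A a Y B p k ω)) *
            (indUpto A a i ω / cumWeight P A a B i ω *
              (ind (A i) (a i) ω / propen P A a B i ω - 1) *
              (breg P A a Y (fun j => G j ∪ B j) p i ω - breg P A a Y B p i ω))) ∂P) -
        (∫ ω,
            (indUpto A a k ω / cumWeight P A a B k ω *
              (ind (A k) (a k) ω / propen P A a B k ω - 1) *
              (breg P A a Y (fun j => G j ∪ B j) p k ω - breg P A a Y B p k ω)) ∂P) *
          (∫ ω,
              (indUpto A a i ω / cumWeight P A a B i ω *
                (ind (A i) (a i) ω / propen P A a B i ω - 1) *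
                (breg P A a Y (fun j => G j ∪ B j) p i ω - breg P A a Y B p i ω)) ∂P) = 0) := by
  obtain ⟨c, hc, hcB⟩ := hBpos
  have hsub : ∀ {j k : ℕ}, j ≤ k → k ≤ p → G j ∪ B j ⊆ G k ∪ B k := by
    intro j k hjk hk
    rw [hcover k hk, hcover j (hjk.trans hk)]
    exact Set.union_subset_union (Set.image_mono (Set.Iio_subset_Iio hjk))
      (Set.biUnion_subset_biUnion_left (Set.Iic_subset_Iic.2 hjk))
  have hGB : ∀ {j k : ℕ}, j ≤ k → k ≤ p → genSig (G j ∪ B j) ≤ genSig (G k ∪ B k) :=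
    fun hjk hk => genSig_mono (hsub hjk hk)
  have hB : ∀ {j k : ℕ}, j ≤ k → k ≤ p → genSig (B j) ≤ genSig (G k ∪ B k) :=
    fun hjk hk => genSig_mono (Set.subset_union_right.trans (hsub hjk hk))
  have hA_past : ∀ {j k : ℕ}, j < k → k ≤ p → Measurable[genSig (G k ∪ B k)] (A j) := by
    intro j k hjk hk
    refine measurable_genSig_of_mem ?_
    rw [hcover k hk]
    exact Or.inl ⟨j, hjk, rfl⟩
  have hweight : ∀ {j k : ℕ}, j ≤ k → k ≤ p → Measurable[genSig (G k ∪ B k)]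
      fun ω => indUpto A a j ω / cumWeight P A a B j ω := fun hjk hk =>
    measurable_indUpto_div_cumWeight P a (fun l hl => hA_past (hl.trans_le hjk) hk)
      (fun l hl => hB (hl.le.trans hjk) hk)
  have hdiff : ∀ {j k : ℕ}, j ≤ k → k ≤ p → Measurable[genSig (G k ∪ B k)]
      fun ω => breg P A a Y (fun j => G j ∪ B j) p j ω - breg P A a Y B p j ω := by
    intro j k hjk hk
    exact Measurable.sub
      ((measurable_breg P A a Y (fun j => G j ∪ B j) (hjk.trans hk)).mono (hGB hjk hk) le_rfl)
      ((measurable_breg P A a Y B (hjk.trans hk)).mono (hB hjk hk) le_rfl)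
  have horth : ∀ {k : ℕ}, k ≤ p → ∀ W : Ω → ℝ, Measurable[genSig (G k ∪ B k)] W →
      ∫ ω, W ω * (ind (A k) (a k) ω / propen P A a B k ω - 1) ∂P = 0 := by
    intro k hk W hW
    refine integral_mul_div_sub_one_eq_zero (m := genSig (G k ∪ B k)) ?_ hW.stronglyMeasurable ?_
      ((stronglyMeasurable_propen P A a B k).mono (hB le_rfl hk)) ?_ hc (hcB k hk)
    · rw [genSig_union]
      exact sup_le (hGle k) (hBle k)
    · rw [ind_eq_indicator]
      exact (integrable_const 1).indicator (hA k (measurableSet_singleton _))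
    · rw [propen, ind_eq_indicator, genSig_union, sup_comm]
      exact condExp_indicator_sup_of_condIndep (hBle k) (hA k).comap_le (hGle k) (hCI k hk)
        ⟨{a k}, measurableSet_singleton _, rfl⟩
  intro i k hik hk
  have hmean : ∫ ω, (indUpto A a k ω / cumWeight P A a B k ω *
      (ind (A k) (a k) ω / propen P A a B k ω - 1) *
      (breg P A a Y (fun j => G j ∪ B j) p k ω - breg P A a Y B p k ω)) ∂P = 0 := by
    rw [← horth hk _ ((hweight le_rfl hk).mul (hdiff le_rfl hk))]
    exact integral_congr_ae (.of_forall fun ω => mul_right_comm _ _ _)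
  have hprod : ∫ ω, ((indUpto A a k ω / cumWeight P A a B k ω *
        (ind (A k) (a k) ω / propen P A a B k ω - 1) *
        (breg P A a Y (fun j => G j ∪ B j) p k ω - breg P A a Y B p k ω)) *
      (indUpto A a i ω / cumWeight P A a B i ω *
        (ind (A i) (a i) ω / propen P A a B i ω - 1) *
        (breg P A a Y (fun j => G j ∪ B j) p i ω - breg P A a Y B p i ω))) ∂P = 0 := by
    have hres : Measurable[genSig (G k ∪ B k)]
        fun ω => ind (A i) (a i) ω / propen P A a B i ω - 1 :=
      Measurable.sub_const (Measurable.div (measurable_ind (hA_past hik hk) (a i))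
        ((stronglyMeasurable_propen P A a B i).measurable.mono (hB hik.le hk) le_rfl)) 1
    rw [← horth hk _ (((hweight le_rfl hk).mul (hdiff le_rfl hk)).mul
      (((hweight hik.le hk).mul hres).mul (hdiff hik.le hk)))]
    refine integral_congr_ae (.of_forall fun ω => ?_)
    simp only [Pi.mul_apply]
    ring
  refine ⟨hprod, ?_⟩
  rw [hprod, hmean, zero_mul, sub_zero]
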